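/- arXiv:1907.09826 — 2 statements merged into one kernel-verified Lean document; each statement's English description precedes it below -/
import Mathlib

section
/- Let k ≥ 2 and let F be a strongly convex Minkowski norm on ℝ^m which is of class C^{k+1} on ℝ^m ∖ {0}. Then the Legendre map ℓ is a homeomorphism of ℝ^m onto (ℝ^m)^*, it maps ℝ^m ∖ {0} bijectively onto (ℝ^m)^* ∖ {0}, and its restriction to ℝ^m ∖ {0} is a C^{k−1} diffeomorphism onto (ℝ^m)^* ∖ {0}. -/
open scoped Topology Classical
open MeasureTheory
noncomputable section

/-- One half of the second Fréchet derivative of `F²` at `v`, evaluated on `(w₁, w₂)`: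
the fundamental tensor of `F`. -/
def fundTensor {V : Type*} [NormedAddCommGroup V] [NormedSpace ℝ V]
    (F : V → ℝ) (v w₁ w₂ : V) : ℝ :=
  (1 / 2) * fderiv ℝ (fderiv ℝ (fun u => (F u) ^ 2)) v w₁ w₂

/-- A strongly convex Minkowski norm on a real normed space. -/
structure IsMinkowskiNorm {V : Type*} [NormedAddCommGroup V] [NormedSpace ℝ V]
    (F : V → ℝ) : Prop where
  continuous : Continuous F
  map_zero : F 0 = 0
  pos : ∀ v : V, v ≠ 0 → 0 < F v
  homog : ∀ lam : ℝ, 0 < lam → ∀ v : V, F (lam • v) = lam * F v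
  smooth : ContDiffOn ℝ 2 F {0}ᶜ
  symm : ∀ v : V, v ≠ 0 → ∀ w₁ w₂ : V, fundTensor F v w₁ w₂ = fundTensor F v w₂ w₁
  posdef : ∀ v : V, v ≠ 0 → ∀ w : V, w ≠ 0 → 0 < fundTensor F v w w

/-- The Legendre map of `F`: `ℓ(v) = (1/2) D(F²)(v)` for `v ≠ 0`, and `ℓ(0) = 0`. -/
def legendre {V : Type*} [NormedAddCommGroup V] [NormedSpace ℝ V]
    (F : V → ℝ) (v : V) : V →L[ℝ] ℝ :=
  if v = 0 then 0 else (1 / 2 : ℝ) • fderiv ℝ (fun u => (F u) ^ 2) v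

/-- The dual co-Finsler norm `F^*(ω) = sup {ω v : F v = 1}`. -/
def dualNorm {V : Type*} [NormedAddCommGroup V] [NormedSpace ℝ V]
    (F : V → ℝ) (ω : V →L[ℝ] ℝ) : ℝ :=
  sSup ((fun v => ω v) '' {v | F v = 1})

section
variable {V : Type*} [NormedAddCommGroup V] [NormedSpace ℝ V] {F : V → ℝ}

theorem legendre_of_ne_zero {v : V} (hv : v ≠ 0) :
    legendre F v = (1 / 2 : ℝ) • fderiv ℝ (fun u => (F u) ^ 2) v := if_neg hv

theorem legendre_zero : legendre F 0 = 0 := if_pos rfl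

namespace IsMinkowskiNorm

theorem contDiffOn_fderiv_sq {n : ℕ} (hsm : ContDiffOn ℝ (n + 1 : ℕ) F {0}ᶜ) :
    ContDiffOn ℝ n (fderiv ℝ (fun u => (F u) ^ 2)) {0}ᶜ :=
  (hsm.pow 2).fderiv_of_isOpen isOpen_compl_singleton (by norm_cast)

theorem contDiffOn_legendre {n : ℕ} (hsm : ContDiffOn ℝ (n + 1 : ℕ) F {0}ᶜ) :
    ContDiffOn ℝ n (legendre F) {0}ᶜ :=
  ((contDiffOn_fderiv_sq hsm).const_smul (1 / 2 : ℝ)).congr fun _ hv => legendre_of_ne_zero hv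

variable (hF : IsMinkowskiNorm F)
include hF

theorem hasFDerivAt_sq {v : V} (hv : v ≠ 0) :
    HasFDerivAt (fun u => (F u) ^ 2) ((2 : ℝ) • legendre F v) v := by
  have h : DifferentiableAt ℝ (fun u => (F u) ^ 2) v :=
    ((hF.smooth.pow 2).contDiffAt (isOpen_compl_singleton.mem_nhds hv)).differentiableAt
      (by norm_num)
  rw [legendre_of_ne_zero hv, smul_smul]
  simpa using h.hasFDerivAt

theorem hasFDerivAt_legendre {v : V} (hv : v ≠ 0) :
    HasFDerivAt (legendre F)
      ((1 / 2 : ℝ) • fderiv ℝ (fderiv ℝ (fun u => (F u) ^ 2)) v) v := by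
  have hn : {0}ᶜ ∈ 𝓝 v := isOpen_compl_singleton.mem_nhds hv
  have h : DifferentiableAt ℝ (fderiv ℝ (fun u => (F u) ^ 2)) v :=
    ((contDiffOn_fderiv_sq (n := 1) hF.smooth).contDiffAt hn).differentiableAt (by norm_num)
  refine (h.hasFDerivAt.const_smul (1 / 2 : ℝ)).congr_of_eventuallyEq ?_
  filter_upwards [hn] with u hu using legendre_of_ne_zero hu

theorem legendre_smul {c : ℝ} (hc : 0 < c) (v : V) : legendre F (c • v) = c • legendre F v := by
  rcases eq_or_ne v 0 with rfl | hv
  · simp [legendre_zero]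
  have hcv : c • v ≠ 0 := smul_ne_zero hc.ne' hv
  have h₁ : HasFDerivAt (fun u => F (c • u) ^ 2) (c • (2 : ℝ) • legendre F (c • v)) v := by
    have := (hF.hasFDerivAt_sq hcv).comp v ((hasFDerivAt_id v).const_smul c)
    refine this.congr_fderiv ?_
    ext w
    simp
  have h₂ : HasFDerivAt (fun u => F (c • u) ^ 2) (c ^ 2 • (2 : ℝ) • legendre F v) v := by
    simpa only [hF.homog c hc, mul_pow] using (hF.hasFDerivAt_sq hv).const_mul (c ^ 2)
  have h := h₁.unique h₂
  rw [smul_comm c, smul_comm (c ^ 2), pow_two, mul_smul] at h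
  exact smul_right_injective _ hc.ne' (smul_right_injective _ (two_ne_zero' ℝ) h)

theorem legendre_apply_self (v : V) : legendre F v v = F v ^ 2 := by
  rcases eq_or_ne v 0 with rfl | hv
  · simp [hF.map_zero]
  have h₁ : HasDerivAt (fun t : ℝ => F (t • v) ^ 2) (2 * legendre F v v) 1 := by
    have h := (hasDerivAt_id (1 : ℝ)).smul_const v
    have hv' : (2 : ℝ) • legendre F v = (2 : ℝ) • legendre F ((id (1 : ℝ)) • v) := by simp
    have := HasFDerivAt.comp_hasDerivAt (1 : ℝ)
      (hF.hasFDerivAt_sq (v := id (1 : ℝ) • v) (by simpa using hv)) h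
    simpa [Function.comp_def] using this
  have h₂ : HasDerivAt (fun t : ℝ => F (t • v) ^ 2) (2 * F v ^ 2) 1 := by
    have : HasDerivAt (fun t : ℝ => t ^ 2 * F v ^ 2) (2 * F v ^ 2) 1 := by
      simpa using (hasDerivAt_pow 2 (1 : ℝ)).mul_const (F v ^ 2)
    refine this.congr_of_eventuallyEq ?_
    filter_upwards [lt_mem_nhds one_pos] with t ht
    rw [hF.homog t ht, mul_pow]
  linarith [h₁.unique h₂]

theorem legendre_sub_apply_pos {v w : V} (hvw : v ≠ w) :
    0 < (legendre F v - legendre F w) (v - w) := by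
  by_cases h0 : ∃ t ∈ Set.Icc (0 : ℝ) 1, w + t • (v - w) = 0
  · obtain ⟨t, ⟨ht0, ht1⟩, ht⟩ := h0
    rcases eq_or_ne v 0 with rfl | hv
    · have := hF.pos w hvw.symm
      simpa [legendre_zero, hF.legendre_apply_self] using pow_pos this 2
    rcases eq_or_ne w 0 with rfl | hw
    · have := hF.pos v hv
      simpa [legendre_zero, hF.legendre_apply_self] using pow_pos this 2
    have ht1' : t < 1 := lt_of_le_of_ne ht1 (by rintro rfl; simp [hv] at ht)
    have ht0' : 0 < t := lt_of_le_of_ne ht0 (by rintro rfl; simp [hw] at ht)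
    have hlin (f : V →L[ℝ] ℝ) : f w + t * (f v - f w) = 0 := by
      simpa using congrArg f ht
    have h₁ := hlin (legendre F v)
    have h₂ := hlin (legendre F w)
    rw [hF.legendre_apply_self] at h₁ h₂
    have hFv := pow_pos (hF.pos v hv) 2
    have hFw := pow_pos (hF.pos w hw) 2
    have h₃ : legendre F v w < 0 := by
      by_contra! h
      nlinarith [mul_nonneg (sub_nonneg.2 ht1) h, mul_pos ht0' hFv]
    have h₄ : legendre F w v < 0 := by
      by_contra! h
      nlinarith [mul_nonneg ht0 h, mul_pos (sub_pos.2 ht1') hFw]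
    simp only [sub_apply, map_sub, hF.legendre_apply_self]
    linarith
  · push Not at h0
    have hd : ∀ t ∈ Set.Icc (0 : ℝ) 1, HasDerivAt
        (fun s : ℝ => legendre F (w + s • (v - w)) (v - w))
        (fundTensor F (w + t • (v - w)) (v - w) (v - w)) t := by
      intro t ht
      have h : HasDerivAt (fun s : ℝ => w + s • (v - w)) (v - w) t := by
        simpa using ((hasDerivAt_id t).smul_const (v - w)).const_add w
      have h' := (hF.hasFDerivAt_legendre (h0 t ht)).comp_hasDerivAt t h
      exact ((ContinuousLinearMap.apply ℝ ℝ (v - w)).hasFDerivAt.comp_hasDerivAt t h').congr_deriv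
        rfl
    obtain ⟨t, ht, hslope⟩ := exists_hasDerivAt_eq_slope _ _ (zero_lt_one' ℝ)
      (fun t ht => (hd t ht).continuousAt.continuousWithinAt)
      (fun t ht => hd t (Set.Ioo_subset_Icc_self ht))
    have := hF.posdef _ (h0 t (Set.Ioo_subset_Icc_self ht)) (v - w) (sub_ne_zero.2 hvw)
    rw [hslope] at this
    simpa using this

theorem legendre_injective : Function.Injective (legendre F) := by
  intro v w h
  by_contra hvw
  simpa [h] using hF.legendre_sub_apply_pos hvw

variable [FiniteDimensional ℝ V]

theorem exists_pos_mul_norm_le : ∃ c > 0, ∀ v, c * ‖v‖ ≤ F v := by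
  obtain ⟨c, hc, h⟩ := (isCompact_sphere (0 : V) 1).exists_forall_le' (a := 0)
    hF.continuous.continuousOn (fun v hv => hF.pos v (ne_zero_of_mem_unit_sphere ⟨v, hv⟩))
  refine ⟨c, hc, fun v => ?_⟩
  rcases eq_or_ne v 0 with rfl | hv
  · simp [hF.map_zero]
  have hv' := norm_pos_iff.2 hv
  have := h (‖v‖⁻¹ • v) (by simp [norm_smul, hv'.ne'])
  rwa [hF.homog _ (inv_pos.2 hv'), ← div_eq_inv_mul, le_div_iff₀ hv'] at this

theorem exists_norm_legendre_le : ∃ C, ∀ v, ‖legendre F v‖ ≤ C * ‖v‖ := by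
  obtain ⟨C, h⟩ := (isCompact_sphere (0 : V) 1).exists_bound_of_continuousOn
    ((contDiffOn_legendre (n := 1) hF.smooth).continuousOn.mono
      fun v hv => ne_zero_of_mem_unit_sphere ⟨v, hv⟩)
  refine ⟨C, fun v => ?_⟩
  rcases eq_or_ne v 0 with rfl | hv
  · simp [legendre_zero]
  have hv' := norm_pos_iff.2 hv
  have := h (‖v‖⁻¹ • v) (by simp [norm_smul, hv'.ne'])
  rwa [hF.legendre_smul (inv_pos.2 hv'), norm_smul, norm_inv, norm_norm, ← div_eq_inv_mul,
    div_le_iff₀ hv'] at this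

theorem continuous_legendre : Continuous (legendre F) := by
  refine continuous_iff_continuousAt.2 fun v => ?_
  rcases eq_or_ne v 0 with rfl | hv
  · obtain ⟨C, hC⟩ := hF.exists_norm_legendre_le
    rw [ContinuousAt, legendre_zero]
    refine squeeze_zero_norm hC ?_
    have : Continuous fun v : V => C * ‖v‖ := by fun_prop
    simpa using this.tendsto 0
  · exact (hF.hasFDerivAt_legendre hv).continuousAt

theorem exists_pos_mul_norm_le_norm_legendre : ∃ c > 0, ∀ v, c * ‖v‖ ≤ ‖legendre F v‖ := by
  obtain ⟨c, hc, h⟩ := hF.exists_pos_mul_norm_le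
  refine ⟨c ^ 2, pow_pos hc 2, fun v => ?_⟩
  rcases eq_or_ne v 0 with rfl | hv
  · simp
  have h₁ : (c * ‖v‖) ^ 2 ≤ F v ^ 2 := pow_le_pow_left₀ (by positivity) (h v) 2
  have h₂ := (le_abs_self _).trans ((legendre F v).le_opNorm v)
  rw [hF.legendre_apply_self] at h₂
  refine le_of_mul_le_mul_right ?_ (norm_pos_iff.2 hv)
  linarith [mul_pow c ‖v‖ 2, mul_assoc (c ^ 2) ‖v‖ ‖v‖, pow_two ‖v‖]

theorem tendsto_sq_sub_cocompact (ω : V →L[ℝ] ℝ) :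
    Filter.Tendsto (fun v => F v ^ 2 - 2 * ω v) (Filter.cocompact V) Filter.atTop := by
  obtain ⟨c, hc, h⟩ := hF.exists_pos_mul_norm_le
  have key : Filter.Tendsto (fun r : ℝ => r * (c ^ 2 * r - 2 * ‖ω‖)) Filter.atTop Filter.atTop :=
    Filter.tendsto_id.atTop_mul_atTop₀ (Filter.tendsto_atTop_add_const_right _ _
      (Filter.tendsto_id.const_mul_atTop (pow_pos hc 2)))
  refine Filter.tendsto_atTop_mono (fun v => ?_) (key.comp (tendsto_norm_cocompact_atTop (E := V)))
  have h₁ : (c * ‖v‖) ^ 2 ≤ F v ^ 2 := pow_le_pow_left₀ (by positivity) (h v) 2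
  have h₂ := (le_abs_self _).trans (ω.le_opNorm v)
  simp only [Function.comp_apply]
  nlinarith

theorem legendre_surjective : Function.Surjective (legendre F) := by
  intro ω
  rcases eq_or_ne ω 0 with rfl | hω
  · exact ⟨0, legendre_zero⟩
  have hcont := hF.continuous
  obtain ⟨v, hv⟩ := Continuous.exists_forall_le (f := fun v => F v ^ 2 - 2 * ω v) (by fun_prop)
    (hF.tendsto_sq_sub_cocompact ω)
  have hv0 : v ≠ 0 := by
    rintro rfl
    obtain ⟨u, hu⟩ : ∃ u, 0 < ω u := by
      obtain ⟨u, hu⟩ := DFunLike.ne_iff.1 hω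
      rcases lt_or_gt_of_ne hu with hu | hu
      · exact ⟨-u, by simpa using hu⟩
      · exact ⟨u, by simpa using hu⟩
    have hFu : 0 < F u ^ 2 := pow_pos (hF.pos u (by rintro rfl; simp at hu)) 2
    have ht : 0 < ω u / F u ^ 2 := div_pos hu hFu
    have := hv ((ω u / F u ^ 2) • u)
    simp only [hF.map_zero, hF.homog _ ht, map_smul, smul_eq_mul, _root_.map_zero, mul_pow] at this
    have h₁ : (ω u / F u ^ 2) ^ 2 * F u ^ 2 = ω u / F u ^ 2 * ω u := by field_simp
    nlinarith [mul_pos ht hu]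
  refine ⟨v, ?_⟩
  have hmin : IsLocalMin (fun v => F v ^ 2 - 2 * ω v) v := Filter.Eventually.of_forall hv
  have h := hmin.hasFDerivAt_eq_zero
    ((hF.hasFDerivAt_sq hv0).sub (ω.hasFDerivAt.const_mul 2))
  rw [← smul_sub] at h
  exact sub_eq_zero.1 ((smul_eq_zero_iff_right (two_ne_zero' ℝ)).1 h)

theorem isProperMap_legendre : IsProperMap (legendre F) := by
  refine isProperMap_iff_tendsto_cocompact.2 ⟨hF.continuous_legendre, ?_⟩
  obtain ⟨c, hc, h⟩ := hF.exists_pos_mul_norm_le_norm_legendre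
  rw [← Metric.cobounded_eq_cocompact (α := V →L[ℝ] ℝ), ← comap_norm_atTop (E := V →L[ℝ] ℝ), Filter.tendsto_comap_iff]
  exact Filter.tendsto_atTop_mono h ((tendsto_norm_cocompact_atTop (E := V)).const_mul_atTop hc)

/-- The Legendre map as a homeomorphism onto the dual space. -/
def legendreHomeomorph : V ≃ₜ (V →L[ℝ] ℝ) :=
  (Equiv.ofBijective (legendre F)
    ⟨hF.legendre_injective, hF.legendre_surjective⟩).toHomeomorphOfContinuousClosed
    hF.continuous_legendre hF.isProperMap_legendre.isClosedMap

theorem legendreHomeomorph_apply (v : V) : hF.legendreHomeomorph v = legendre F v := rfl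

theorem exists_hasFDerivAt_legendre_equiv {v : V} (hv : v ≠ 0) :
    ∃ A : V ≃L[ℝ] (V →L[ℝ] ℝ), HasFDerivAt (legendre F) (A : V →L[ℝ] (V →L[ℝ] ℝ)) v := by
  set B := (1 / 2 : ℝ) • fderiv ℝ (fderiv ℝ (fun u => (F u) ^ 2)) v with hB
  have hinj : Function.Injective (B : V →ₗ[ℝ] (V →L[ℝ] ℝ)) := by
    refine (injective_iff_map_eq_zero _).2 fun w hw => ?_
    by_contra hw0
    have h₁ := hF.posdef v hv w hw0
    have h₂ : B w w = 0 := by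
      have : B w = 0 := hw
      simp [this]
    exact h₁.ne' (by simpa [hB, fundTensor] using h₂)
  have hfin : Module.finrank ℝ V = Module.finrank ℝ (V →L[ℝ] ℝ) := by
    rw [← (LinearMap.toContinuousLinearMap (𝕜 := ℝ) (E := V) (F' := ℝ)).finrank_eq]
    exact (Subspace.dual_finrank_eq (K := ℝ) (V := V)).symm
  refine ⟨(LinearEquiv.ofInjectiveOfFinrankEq _ hinj hfin).toContinuousLinearEquiv, ?_⟩
  exact (hF.hasFDerivAt_legendre hv).congr_fderiv (by ext; rfl)

theorem contDiffOn_legendreHomeomorph_symm {n : ℕ} (hsm : ContDiffOn ℝ (n + 1 : ℕ) F {0}ᶜ) :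
    ContDiffOn ℝ n hF.legendreHomeomorph.symm {0}ᶜ := by
  intro ω hω
  have hv : hF.legendreHomeomorph.symm ω ≠ 0 := by
    intro h
    apply hω
    rw [← hF.legendreHomeomorph.apply_symm_apply ω, h]
    exact legendre_zero
  obtain ⟨A, hA⟩ := hF.exists_hasFDerivAt_legendre_equiv hv
  exact (hF.legendreHomeomorph.toOpenPartialHomeomorph.contDiffAt_symm (a := ω) trivial hA
    ((contDiffOn_legendre hsm).contDiffAt
      (isOpen_compl_singleton.mem_nhds hv))).contDiffWithinAt

theorem bijOn_legendre : Set.BijOn (legendre F) {0}ᶜ {0}ᶜ := by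
  refine ⟨fun v hv h => hv (hF.legendre_injective (h.trans legendre_zero.symm)),
    hF.legendre_injective.injOn, fun ω hω => ?_⟩
  obtain ⟨v, rfl⟩ := hF.legendre_surjective ω
  exact ⟨v, fun hv => hω (by rw [hv]; exact legendre_zero), rfl⟩

end IsMinkowskiNorm
end

/-- for a `C^{k+1}` (`k ≥ 2`) strongly convex Minkowski norm, the Legendre
map is a homeomorphism of `ℝ^m` onto its dual, maps `ℝ^m ∖ {0}` bijectively onto the
punctured dual space, and restricts to a `C^{k-1}` diffeomorphism away from the origin. -/
theorem legendre_homeomorph_and_diffeo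
    {m : ℕ} (hm : 2 ≤ m) (k : ℕ) (hk : 2 ≤ k)
    (F : EuclideanSpace ℝ (Fin m) → ℝ) (hF : IsMinkowskiNorm F)
    (hsm : ContDiffOn ℝ (k + 1 : ℕ) F ({0}ᶜ : Set (EuclideanSpace ℝ (Fin m)))) :
    (∃ e : EuclideanSpace ℝ (Fin m) ≃ₜ (EuclideanSpace ℝ (Fin m) →L[ℝ] ℝ),
        ∀ v, e v = legendre F v) ∧
    Set.BijOn (legendre F) ({0}ᶜ : Set (EuclideanSpace ℝ (Fin m)))
        ({0}ᶜ : Set (EuclideanSpace ℝ (Fin m) →L[ℝ] ℝ)) ∧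
    ContDiffOn ℝ (k - 1 : ℕ) (legendre F) ({0}ᶜ : Set (EuclideanSpace ℝ (Fin m))) ∧
    ∃ linv : (EuclideanSpace ℝ (Fin m) →L[ℝ] ℝ) → EuclideanSpace ℝ (Fin m),
      ContDiffOn ℝ (k - 1 : ℕ) linv ({0}ᶜ : Set (EuclideanSpace ℝ (Fin m) →L[ℝ] ℝ)) ∧
      (∀ v : EuclideanSpace ℝ (Fin m), v ≠ 0 → linv (legendre F v) = v) ∧
      (∀ ω : EuclideanSpace ℝ (Fin m) →L[ℝ] ℝ, ω ≠ 0 → legendre F (linv ω) = ω) := by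
  have hsm' : ContDiffOn ℝ (k - 1 + 1 : ℕ) F {0}ᶜ := hsm.of_le (by norm_cast; omega)
  exact ⟨⟨hF.legendreHomeomorph, hF.legendreHomeomorph_apply⟩, hF.bijOn_legendre,
    IsMinkowskiNorm.contDiffOn_legendre hsm', hF.legendreHomeomorph.symm,
    hF.contDiffOn_legendreHomeomorph_symm hsm',
    fun v _ => hF.legendreHomeomorph.symm_apply_apply v,
    fun ω _ => hF.legendreHomeomorph.apply_symm_apply ω⟩
end
end

section
/- (Regularity of the averaged metric.) Let U ⊆ ℝ^m (m ≥ 2) be open and let F : U × ℝ^m → ℝ be continuous, of class C⁴ on U × (ℝ^m ∖ {0}), such that for each x ∈ U the function F(x, ·) is a strongly convex Minkowski norm on ℝ^m, with fundamental tensor g(x, y). For x ∈ U let S_x := { y ∈ ℝ^m : F(x, y) = 1 } and let λ denote the (m−1)-dimensional Hausdorff measure on ℝ^m. Then for all u, v ∈ ℝ^m the function x ↦ ( ∫_{S_x} g(x, y)[u, v] dλ(y) ) / λ(S_x) is well defined (0 < λ(S_x) < ∞) and of class C² on U. -/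
open scoped Topology Classical
open MeasureTheory
noncomputable section

open scoped ENNReal NNReal Pointwise
open Set Metric Filter

/-- Integrating a jointly `C^n` function over a compact parameter space of finite measure
yields a `C^n` function. -/
theorem contDiffOn_integral_of_compactSpace {X : Type} {Y S : Type*}
    [NormedAddCommGroup X] [NormedSpace ℝ X] [FiniteDimensional ℝ X]
    [NormedAddCommGroup Y] [NormedSpace ℝ Y]
    [TopologicalSpace S] [CompactSpace S] [T2Space S] [SecondCountableTopology S]
    [MeasurableSpace S] [BorelSpace S] (μ : Measure S) [IsFiniteMeasure μ]
    {U : Set X} (hU : IsOpen U) {V : Set Y} (hV : IsOpen V)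
    {i : S → Y} (hi : Continuous i) (hiV : ∀ s, i s ∈ V) (n : ℕ)
    {G : Type} [NormedAddCommGroup G] [NormedSpace ℝ G] {ψ : X → Y → G}
    (hψ : ContDiffOn ℝ n (Function.uncurry ψ) (U ×ˢ V)) :
    ContDiffOn ℝ n (fun x => ∫ s, ψ x (i s) ∂μ) U := by
  have hprod {H : Type} [TopologicalSpace H] {φ : X → Y → H}
      (hφ : ContinuousOn (Function.uncurry φ) (U ×ˢ V)) :
      ContinuousOn (fun p : X × S => φ p.1 (i p.2)) (U ×ˢ univ) :=
    hφ.comp (f := fun p : X × S => (p.1, i p.2)) (by fun_prop) fun p hp => ⟨hp.1, hiV _⟩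
  have hslice {H : Type} [TopologicalSpace H] {φ : X → Y → H}
      (hφ : ContinuousOn (Function.uncurry φ) (U ×ˢ V)) {x : X} (hx : x ∈ U) :
      Continuous fun s => φ x (i s) :=
    (hprod hφ).comp_continuous (f := fun s => (x, s)) (by fun_prop) fun s => ⟨hx, mem_univ _⟩
  have hinteg {H : Type} [NormedAddCommGroup H] [NormedSpace ℝ H] {φ : S → H}
      (hφ : Continuous φ) : Integrable φ μ :=
    integrableOn_univ.1 (hφ.continuousOn.integrableOn_compact isCompact_univ)
  induction n generalizing G with
  | zero =>
    norm_num only [Nat.cast_zero, contDiffOn_zero] at hψ ⊢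
    rw [continuousOn_iff_continuous_domRestrict]
    have : LocallyCompactSpace U := hU.locallyCompactSpace
    have h := continuous_parametric_integral_of_continuous (μ := μ) (X := U)
      (f := fun x s => ψ x (i s)) (s := univ) ?_ isCompact_univ
    · exact h.congr fun x => by simp
    · exact (hprod hψ).comp_continuous (f := fun p : U × S => ((p.1 : X), p.2)) (by fun_prop)
        fun p => ⟨p.1.2, mem_univ _⟩
  | succ n ih =>
    set ψ' : X → Y → X →L[ℝ] G := fun x y => fderiv ℝ (fun x' => ψ x' y) x
    have hUV : IsOpen (U ×ˢ V) := hU.prod hV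
    have hψ' : ContDiffOn ℝ n (Function.uncurry ψ') (U ×ˢ V) := by
      rintro ⟨x, y⟩ hp
      refine ContDiffAt.contDiffWithinAt ?_
      refine ContDiffAt.fderiv (f := fun (p : X × Y) (x' : X) => ψ x' p.2) (g := Prod.fst)
        (n := (n + 1 : ℕ)) ?_ contDiffAt_fst (by norm_cast)
      exact (hψ.contDiffAt (hUV.mem_nhds hp)).comp (((x, y), x) : (X × Y) × X)
        (f := fun q : (X × Y) × X => (q.2, q.1.2)) (by fun_prop)
    have hder : ∀ x ∈ U, ∀ y ∈ V, HasFDerivAt (fun x' => ψ x' y) (ψ' x y) x := by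
      intro x hx y hy
      refine DifferentiableAt.hasFDerivAt ?_
      have h1 : DifferentiableAt ℝ (Function.uncurry ψ) (x, y) :=
        (hψ.contDiffAt (hUV.mem_nhds ⟨hx, hy⟩)).differentiableAt (by norm_cast)
      exact h1.comp x (f := fun x' => (x', y)) (by fun_prop)
    have key : ∀ x ∈ U,
        HasFDerivAt (fun x => ∫ s, ψ x (i s) ∂μ) (∫ s, ψ' x (i s) ∂μ) x := by
      intro x hx
      obtain ⟨K, hK, hKU, hKc⟩ :
          ∃ K ∈ 𝓝 x, K ⊆ U ∧ IsCompact K := local_compact_nhds (hU.mem_nhds hx)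
      obtain ⟨C, hC⟩ := (hKc.prod (isCompact_univ (X := S))).exists_bound_of_continuousOn
        ((hprod hψ'.continuousOn).mono (prod_mono hKU le_rfl))
      refine hasFDerivAt_integral_of_dominated_of_fderiv_le (bound := fun _ => C)
        (F' := fun x s => ψ' x (i s)) hK ?_
        (hinteg (hslice hψ.continuousOn hx)) (hinteg (hslice hψ'.continuousOn hx)).1 ?_
        (integrable_const _) ?_
      · filter_upwards [hU.mem_nhds hx] with z hz
        exact (hinteg (hslice hψ.continuousOn hz)).1
      · exact ae_of_all _ fun s z hz => hC (z, s) ⟨hz, mem_univ _⟩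
      · exact ae_of_all _ fun s z hz => hder z (hKU hz) _ (hiV s)
    push_cast
    rw [contDiffOn_succ_iff_fderiv_of_isOpen hU]
    refine ⟨fun x hx => (key x hx).differentiableAt.differentiableWithinAt, by simp, ?_⟩
    exact (ih hψ').congr fun x hx => (key x hx).fderiv

/-- Two measures which locally satisfy `μ ≤ C ν` for every `C > 1` satisfy `μ ≤ ν`. -/
theorem measure_le_of_forall_locally_le_mul {X : Type*} [TopologicalSpace X]
    [SecondCountableTopology X] [MeasurableSpace X] [OpensMeasurableSpace X] {μ ν : Measure X}
    (h : ∀ C : ℝ≥0, 1 < C → ∀ x : X, ∃ V ∈ 𝓝 x, ∀ A ⊆ V, MeasurableSet A → μ A ≤ C * ν A) :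
    μ ≤ ν := by
  have hC : ∀ C : ℝ≥0, 1 < C → ∀ A, MeasurableSet A → μ A ≤ C * ν A := by
    intro C hC A hA
    choose V hV hVA using h C hC
    obtain ⟨s, hs, hcov⟩ := TopologicalSpace.countable_cover_nhds
      fun x => interior_mem_nhds.2 (hV x)
    have := hs.to_subtype
    rcases isEmpty_or_nonempty s with he | he
    · have : (univ : Set X) = ∅ := by
        rw [← hcov, biUnion_eq_iUnion]; simp
      rw [eq_empty_of_subset_empty ((subset_univ A).trans this.le)]; simp
    obtain ⟨e, he⟩ := exists_surjective_nat s
    set W : ℕ → Set X := disjointed fun k => interior (V (e k))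
    have hWm : ∀ k, MeasurableSet (W k) :=
      fun k => MeasurableSet.disjointed (fun _ => isOpen_interior.measurableSet) k
    have hWu : ⋃ k, W k = univ := by
      rw [iUnion_disjointed, ← hcov, biUnion_eq_iUnion]
      exact he.iUnion_comp fun x : s => interior (V x)
    have hsum (ρ : Measure X) : ρ A = ∑' k, ρ (A ∩ W k) := by
      rw [← measure_iUnion, ← inter_iUnion, hWu, inter_univ]
      · exact fun i j hij => (disjoint_disjointed _ hij).mono inter_subset_right inter_subset_right
      · exact fun k => hA.inter (hWm k)
    rw [hsum μ, hsum ν, ← ENNReal.tsum_mul_left]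
    exact ENNReal.tsum_le_tsum fun k => hVA (e k) _
      (inter_subset_right.trans ((disjointed_subset _ k).trans interior_subset)) (hA.inter (hWm k))
  refine Measure.le_iff.2 fun A hA => ?_
  have hlim : Tendsto (fun C : ℝ≥0 => (C : ℝ≥0∞) * ν A) (𝓝[>] 1) (𝓝 ((1 : ℝ≥0) * ν A)) := by
    refine ENNReal.Tendsto.mul_const ?_ (Or.inl (by simp))
    exact (ENNReal.continuous_coe.tendsto 1).mono_left nhdsWithin_le_nhds
  have := ge_of_tendsto hlim (b := μ A)
    (by filter_upwards [self_mem_nhdsWithin] with C hC' using hC C hC' A hA)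
  simpa using this

/-- In an inner product space of dimension `d + 1`, the `d`-dimensional Hausdorff measure of a
subset of the hyperplane `ℓ = 1` is proportional to `‖ℓ‖` times the volume of the cone over it. -/
theorem exists_hausdorffMeasure_eq_volume_cone (E : Type*) [NormedAddCommGroup E]
    [InnerProductSpace ℝ E] [FiniteDimensional ℝ E] [MeasurableSpace E] [BorelSpace E]
    {d : ℕ} (hd : Module.finrank ℝ E = d + 1) :
    ∃ κ : ℝ≥0, κ ≠ 0 ∧ ∀ ℓ : E →L[ℝ] ℝ, ℓ ≠ 0 → ∀ B : Set E, MeasurableSet B →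
      (∀ y ∈ B, ℓ y = 1) → μH[(d : ℝ)] B = κ * ‖ℓ‖ₑ * volume (Ioo (0 : ℝ) 1 • B) := by
  set c : ℝ≥0 :=
    Measure.addHaarScalarFactor (volume : Measure (EuclideanSpace ℝ (Fin d))) μH[(d : ℝ)] with hc
  have hc0 : c ≠ 0 := Measure.addHaarScalarFactor_volume_hausdorffMeasure_ne_zero d
  refine ⟨c⁻¹ * (d + 1), by positivity, fun ℓ hℓ B hB hB1 => ?_⟩
  set w : E := (InnerProductSpace.toDual ℝ E).symm ℓ with hw
  have hwℓ : ∀ y, inner ℝ w y = ℓ y := fun y => by simp [hw]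
  have hwn : ‖w‖ = ‖ℓ‖ := by simp [hw]
  have hℓ0 : 0 < ‖ℓ‖ := norm_pos_iff.2 hℓ
  have hw0 : w ≠ 0 := by rw [← norm_pos_iff, hwn]; exact hℓ0
  set v : E := (‖w‖ ^ 2)⁻¹ • w with hv
  have hvn : ‖v‖ = ‖ℓ‖⁻¹ := by
    rw [hv, norm_smul, hwn]; simp; field_simp
  have hv0 : v ≠ 0 := by rw [← norm_pos_iff, hvn]; positivity
  have hvℓ : ∀ y, inner ℝ v y = (‖w‖ ^ 2)⁻¹ * ℓ y := fun y => by
    rw [hv, real_inner_smul_left, hwℓ]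
  have hℓv : ℓ v = 1 := by
    rw [← hwℓ, hv, real_inner_smul_right, real_inner_self_eq_norm_sq]; field_simp
  have hcone : Ioo (0 : ℝ) 1 • B = {y | ℓ y ∈ Ioo (0 : ℝ) 1 ∧ (ℓ y)⁻¹ • y ∈ B} := by
    ext y
    rw [Set.mem_smul]
    constructor
    · rintro ⟨t, ht, b, hb, rfl⟩
      have : ℓ (t • b) = t := by simp [hB1 b hb]
      simp only [mem_ofPred_eq, this]
      exact ⟨ht, by rwa [smul_smul, inv_mul_cancel₀ ht.1.ne', one_smul]⟩
    · rintro ⟨h1, h2⟩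
      exact ⟨ℓ y, h1, _, h2, by rw [smul_smul, mul_inv_cancel₀ h1.1.ne', one_smul]⟩
  have hmeas : MeasurableSet (Ioo (0 : ℝ) 1 • B) := by
    rw [hcone]
    exact (ℓ.measurable measurableSet_Ioo).inter ((by fun_prop : Measurable _) hB)
  have hslice : ∀ x : ℝ, (Ioo (0 : ℝ) 1 • B) ∩ AffineSubspace.mk' (x • v +ᵥ (0 : E)) (ℝ ∙ v)ᗮ
      = if x ∈ Ioo (0 : ℝ) 1 then x • B else ∅ := by
    intro x
    have hmk : ∀ y, y ∈ (AffineSubspace.mk' (x • v +ᵥ (0 : E)) (ℝ ∙ v)ᗮ : Set E) ↔ ℓ y = x := by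
      intro y
      rw [SetLike.mem_coe, AffineSubspace.mem_mk',
        Submodule.mem_orthogonal_singleton_iff_inner_right, hvℓ]
      have : (‖w‖ ^ 2)⁻¹ ≠ 0 := by positivity
      simp [hℓv, this, sub_eq_zero]
    ext y
    rw [mem_inter_iff, hmk, hcone]
    split_ifs with hx
    · rw [mem_smul_set_iff_inv_smul_mem₀ hx.1.ne']
      constructor
      · rintro ⟨⟨-, h⟩, rfl⟩; exact h
      · intro h
        have hy : ℓ y = x := by
          have := hB1 _ h
          simp only [map_smul, smul_eq_mul] at this
          field_simp [hx.1.ne'] at this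
          exact this
        exact ⟨⟨by rwa [hy], by rwa [hy]⟩, hy⟩
    · simp only [mem_empty_iff_false, iff_false]
      rintro ⟨⟨h, -⟩, rfl⟩
      exact hx h
  have hvol := EuclideanGeometry.euclideanHausdorffMeasure_eq_lintegral (0 : E) hv0 hmeas
  rw [InnerProductSpace.euclideanHausdorffMeasure_eq_volume, hd, Nat.add_sub_cancel] at hvol
  have hinteg : ∫⁻ x : ℝ, μHE[d] ((Ioo (0 : ℝ) 1 • B) ∩
      AffineSubspace.mk' (x • v +ᵥ (0 : E)) (ℝ ∙ v)ᗮ) = (d + 1 : ℝ≥0∞)⁻¹ * (c * μH[(d : ℝ)] B) := by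
    have hE : μHE[d] B = c * μH[(d : ℝ)] B := by
      rw [Measure.euclideanHausdorffMeasure_def]; rfl
    have : ∀ x : ℝ, μHE[d] ((Ioo (0 : ℝ) 1 • B) ∩
        AffineSubspace.mk' (x • v +ᵥ (0 : E)) (ℝ ∙ v)ᗮ) =
        (Ioo (0 : ℝ) 1).indicator (fun x => ENNReal.ofReal (x ^ d) * μHE[d] B) x := by
      intro x
      rw [hslice, indicator_apply]
      split_ifs with hx
      · rw [Measure.euclideanHausdorffMeasure_smul₀ _ hx.1.ne', ENNReal.smul_def, smul_eq_mul]
        congr 1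
        rw [← ENNReal.ofReal_coe_nnreal]
        simp [abs_of_pos hx.1]
      · simp
    simp_rw [this]
    rw [lintegral_indicator measurableSet_Ioo, lintegral_mul_const _ (by fun_prop), hE]
    congr 1
    rw [← ofReal_integral_eq_lintegral_ofReal, ← integral_Ioc_eq_integral_Ioo,
      ← intervalIntegral.integral_of_le zero_le_one, integral_pow]
    · simp
      rw [ENNReal.ofReal_inv_of_pos (by positivity)]
      norm_cast
    · exact ((continuous_pow d).integrableOn_Icc (a := 0) (b := 1)).mono_set Ioo_subset_Icc_self
    · filter_upwards [ae_restrict_mem measurableSet_Ioo] with x hx using pow_nonneg hx.1.le _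
  rw [hvol, hinteg]
  have h1 : ‖ℓ‖ₑ * ‖v‖ₑ = 1 := by
    rw [← ofReal_norm, ← ofReal_norm, hvn, ← ENNReal.ofReal_mul hℓ0.le, mul_inv_cancel₀ hℓ0.ne']
    simp
  have h2 : (d + 1 : ℝ≥0∞) * (d + 1 : ℝ≥0∞)⁻¹ = 1 :=
    ENNReal.mul_inv_cancel (by positivity) (by finiteness)
  have h3 : ((c⁻¹ : ℝ≥0) : ℝ≥0∞) * c = 1 := by
    rw [← ENNReal.coe_mul, inv_mul_cancel₀ hc0, ENNReal.coe_one]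
  push_cast
  generalize (d + 1 : ℝ≥0∞) = q at h2 ⊢
  calc μH[(d : ℝ)] B = (((c⁻¹ : ℝ≥0) : ℝ≥0∞) * c) * (‖ℓ‖ₑ * ‖v‖ₑ) * (q * q⁻¹) * μH[(d : ℝ)] B := by
        rw [h1, h2, h3]; simp
    _ = _ := by ring

/-- Euler's identity for positively homogeneous functions of degree one. -/
theorem HasFDerivAt.apply_self_of_homogeneous {E : Type*} [NormedAddCommGroup E]
    [NormedSpace ℝ E] {N : E → ℝ} {ℓ : E →L[ℝ] ℝ} {a : E} (hN : HasFDerivAt N ℓ a)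
    (hhom : ∀ t : ℝ, 0 < t → ∀ y, N (t • y) = t * N y) : ℓ a = N a := by
  have h1 : HasDerivAt (fun t : ℝ => N (t • a)) (ℓ a) 1 := by
    have h2 : HasDerivAt (fun t : ℝ => t • a) a 1 := by
      simpa using (hasDerivAt_id (1 : ℝ)).smul_const a
    exact HasFDerivAt.comp_hasDerivAt (1 : ℝ) (by simpa using hN) h2
  have h3 : HasDerivAt (fun t : ℝ => N (t • a)) (N a) 1 := by
    refine (hasDerivAt_mul_const (N a)).congr_of_eventuallyEq ?_
    filter_upwards [lt_mem_nhds (zero_lt_one' ℝ)] with t ht using hhom t ht a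
  exact h1.unique h3

theorem eq_of_pos_smul_eq_of_norm_eq_one {E : Type*} [NormedAddCommGroup E] [NormedSpace ℝ E]
    {s t : ℝ} (hs : 0 < s) (ht : 0 < t) {x y : E} (hx : ‖x‖ = 1) (hy : ‖y‖ = 1)
    (h : s • x = t • y) : x = y := by
  have hst : s = t := by
    have := congrArg norm h
    rwa [norm_smul, norm_smul, hx, hy, mul_one, mul_one, Real.norm_of_nonneg hs.le,
      Real.norm_of_nonneg ht.le] at this
  subst hst
  exact smul_right_injective E hs.ne' h

/-- Near a point `a` with `N a = ℓ a = 1`, where `ℓ` is the derivative of `N` at `a`, the radial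
projection of the level set `N = 1` to its tangent hyperplane `ℓ = 1` is almost isometric. -/
theorem eventually_norm_radialProjection_sub_le {E : Type*} [NormedAddCommGroup E]
    [NormedSpace ℝ E] {N : E → ℝ} {ℓ : E →L[ℝ] ℝ} {a : E} (hN : HasStrictFDerivAt N ℓ a)
    (hℓ : ℓ a = 1) {ε : ℝ≥0} (hε : 0 < ε) :
    ∃ W ∈ 𝓝 a, ∀ y ∈ W, ∀ z ∈ W, N y = 1 → N z = 1 →
      ‖((ℓ y)⁻¹ • y - (ℓ z)⁻¹ • z) - (y - z)‖ ≤ ε * ‖y - z‖ := by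
  have hinv : HasStrictFDerivAt (fun y => (ℓ y)⁻¹) _ a :=
    (hasStrictDerivAt_inv (x := ℓ a) (by simp [hℓ])).comp_hasStrictFDerivAt a ℓ.hasStrictFDerivAt
  have hG : HasStrictFDerivAt (fun y => (ℓ y)⁻¹ • y - y + N y • a) (0 : E →L[ℝ] E) a := by
    refine HasStrictFDerivAt.congr_fderiv
      (((hinv.fun_smul (hasStrictFDerivAt_id a)).fun_sub (hasStrictFDerivAt_id a)).fun_add
        (hN.smul_const a)) ?_
    ext y
    simp [hℓ]
  obtain ⟨W, hW, hWG⟩ := hG.approximates_deriv_on_nhds (Or.inr hε)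
  refine ⟨W, hW, fun y hy z hz hNy hNz => ?_⟩
  have := hWG y hy z hz
  simp only [hNy, hNz, zero_apply, sub_zero] at this
  convert this using 2
  module

/-- If `ψ` is within a factor `c` of `r` on a set `D`, then the volumes of the cone over
`{ψ θ • θ | θ ∈ D}` and of the cone over `D` scaled by `r` agree up to `c ^ dim`. -/
theorem volume_cone_le_and_le {E : Type*} [NormedAddCommGroup E] [InnerProductSpace ℝ E]
    [FiniteDimensional ℝ E] [MeasurableSpace E] [BorelSpace E] {n : ℕ}
    (hn : Module.finrank ℝ E = n) {D : Set E} {ψ : E → ℝ} {c : ℝ≥0} {r : ℝ} (hc : 0 < c)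
    (hr : 0 < r) (h₁ : ∀ θ ∈ D, r ≤ c * ψ θ) (h₂ : ∀ θ ∈ D, ψ θ ≤ c * r) :
    volume (Ioo (0 : ℝ) 1 • ((fun θ => ψ θ • θ) '' D)) ≤
        (c : ℝ≥0∞) ^ n * (ENNReal.ofReal (r ^ n) * volume (Ioo (0 : ℝ) 1 • D)) ∧
      ENNReal.ofReal (r ^ n) * volume (Ioo (0 : ℝ) 1 • D) ≤
        (c : ℝ≥0∞) ^ n * volume (Ioo (0 : ℝ) 1 • ((fun θ => ψ θ • θ) '' D)) := by
  have hc' : (0 : ℝ) < c := hc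
  have hvol : ∀ s : ℝ, 0 < s → ∀ A : Set E, volume (s • A) = ENNReal.ofReal (s ^ n) * volume A := by
    intro s hs A
    rw [Measure.addHaar_smul, hn, abs_of_pos (by positivity)]
  have hcn : ENNReal.ofReal ((c : ℝ) ^ n) = (c : ℝ≥0∞) ^ n := by
    rw [ENNReal.ofReal_pow hc'.le, ENNReal.ofReal_coe_nnreal]
  have hψ : ∀ θ ∈ D, 0 < ψ θ := fun θ hθ =>
    pos_of_mul_pos_right (hr.trans_le (h₁ θ hθ)) hc'.le
  constructor
  · rw [← mul_assoc, ← hcn, ← ENNReal.ofReal_mul (by positivity), ← mul_pow,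
      ← hvol _ (by positivity)]
    refine measure_mono ?_
    rintro _ ⟨t, ht, _, ⟨θ, hθ, rfl⟩, rfl⟩
    refine ⟨(t * (ψ θ / (c * r))) • θ, ⟨_, ⟨?_, ?_⟩, θ, hθ, rfl⟩, ?_⟩
    · exact mul_pos ht.1 (div_pos (hψ θ hθ) (by positivity))
    · refine (mul_le_of_le_one_right ht.1.le ?_).trans_lt ht.2
      exact (div_le_one (by positivity)).2 (h₂ θ hθ)
    · simp only [smul_smul]
      congr 1
      field_simp
  · rw [← hcn, ← hvol r hr, ← hvol c hc']
    refine measure_mono ?_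
    rintro _ ⟨_, ⟨t, ht, θ, hθ, rfl⟩, rfl⟩
    refine ⟨(t * (r / (c * ψ θ))) • (ψ θ • θ), ⟨_, ⟨?_, ?_⟩, _, ⟨θ, hθ, rfl⟩, rfl⟩, ?_⟩
    · exact mul_pos ht.1 (div_pos hr (mul_pos hc' (hψ θ hθ)))
    · refine (mul_le_of_le_one_right ht.1.le ?_).trans_lt ht.2
      exact (div_le_one (mul_pos hc' (hψ θ hθ))).2 (h₁ θ hθ)
    · have := hψ θ hθ
      simp only [smul_smul]
      congr 1
      field_simp

/-- Infinitesimal comparison of the `d`-dimensional Hausdorff measure on the level set `N = 1` of a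
positively homogeneous function `N` with the cone measure on the unit sphere. -/
theorem exists_nhds_hausdorffMeasure_radialGraph_le_and_le {E : Type*} [NormedAddCommGroup E]
    [InnerProductSpace ℝ E] [FiniteDimensional ℝ E] [MeasurableSpace E] [BorelSpace E]
    {d : ℕ} (hd : Module.finrank ℝ E = d + 1) {κ : ℝ≥0}
    (hκ : ∀ ℓ : E →L[ℝ] ℝ, ℓ ≠ 0 → ∀ B : Set E, MeasurableSet B →
      (∀ y ∈ B, ℓ y = 1) → μH[(d : ℝ)] B = κ * ‖ℓ‖ₑ * volume (Ioo (0 : ℝ) 1 • B))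
    {N : E → ℝ} (hpos : ∀ y, y ≠ 0 → 0 < N y)
    (hhom : ∀ t : ℝ, 0 < t → ∀ y, N (t • y) = t * N y)
    {θ₀ : E} (hθ₀ : θ₀ ≠ 0) {ℓ : E →L[ℝ] ℝ} (hN : HasStrictFDerivAt N ℓ ((N θ₀)⁻¹ • θ₀))
    (hcont : ContinuousAt N θ₀) {c : ℝ≥0} (hc : 1 < c) :
    ∃ V ∈ 𝓝 θ₀, ∀ D ⊆ V, MeasurableSet D → D ⊆ sphere 0 1 →
      μH[(d : ℝ)] ((fun θ => (N θ)⁻¹ • θ) '' D) ≤ (c : ℝ≥0∞) ^ (2 * d + 1) *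
        (κ * ‖ℓ‖ₑ * (ENNReal.ofReal ((N θ₀)⁻¹ ^ (d + 1)) * volume (Ioo (0 : ℝ) 1 • D))) ∧
      κ * ‖ℓ‖ₑ * (ENNReal.ofReal ((N θ₀)⁻¹ ^ (d + 1)) * volume (Ioo (0 : ℝ) 1 • D)) ≤
        (c : ℝ≥0∞) ^ (2 * d + 1) * μH[(d : ℝ)] ((fun θ => (N θ)⁻¹ • θ) '' D) := by
  have hNθ₀ := hpos θ₀ hθ₀
  have hc' : (1 : ℝ) < c := hc
  have hc0 : (0 : ℝ) < c := by positivity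
  set a : E := (N θ₀)⁻¹ • θ₀ with ha
  have hNa : N a = 1 := by rw [ha, hhom _ (by positivity), inv_mul_cancel₀ hNθ₀.ne']
  have hℓa : ℓ a = 1 := (hN.hasFDerivAt.apply_self_of_homogeneous hhom).trans hNa
  have hℓ0 : ℓ ≠ 0 := by rintro rfl; simp at hℓa
  have hℓθ₀ : ℓ θ₀ = N θ₀ := by
    rw [ha, map_smul, smul_eq_mul] at hℓa
    field_simp at hℓa
    exact hℓa
  set r : ℝ := (N θ₀)⁻¹ with hr
  have hr0 : 0 < r := by positivity
  set ε : ℝ≥0 := 1 - c⁻¹ with hεdef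
  have hεc : (ε : ℝ) = 1 - (c : ℝ)⁻¹ := by
    rw [hεdef, NNReal.coe_sub (inv_le_one_of_one_le₀ hc.le)]; simp
  have hε : 0 < ε := tsub_pos_of_lt (inv_lt_one_of_one_lt₀ hc)
  obtain ⟨W, hW, hWT⟩ := eventually_norm_radialProjection_sub_le hN hℓa hε
  have hΦc : ContinuousAt (fun θ => (N θ)⁻¹ • θ) θ₀ :=
    (hcont.inv₀ hNθ₀.ne').smul continuousAt_id
  have hψc : ContinuousAt (fun θ => (ℓ θ)⁻¹) θ₀ :=
    ℓ.continuous.continuousAt.inv₀ (by rw [hℓθ₀]; exact hNθ₀.ne')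
  have hev : ∀ᶠ θ in 𝓝 θ₀, (N θ)⁻¹ • θ ∈ W ∧ r < c * (ℓ θ)⁻¹ ∧ (ℓ θ)⁻¹ < c * r := by
    refine (hΦc.eventually hW).and (Eventually.and ?_ ?_)
    · refine (hψc.const_mul (c : ℝ)).eventually (lt_mem_nhds ?_)
      simp only [hℓθ₀]
      exact lt_mul_of_one_lt_left hr0 hc'
    · refine hψc.eventually (gt_mem_nhds ?_)
      simp only [hℓθ₀]
      exact lt_mul_of_one_lt_left hr0 hc'
  refine ⟨_, hev, fun D hDV hDm hDs => ?_⟩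
  have hD1 : ∀ θ ∈ D, ‖θ‖ = 1 := fun θ hθ => by simpa using hDs hθ
  have hDN : ∀ θ ∈ D, 0 < N θ := fun θ hθ => hpos θ (by
    rw [← norm_pos_iff, hD1 θ hθ]; exact one_pos)
  have hDℓ : ∀ θ ∈ D, 0 < ℓ θ := fun θ hθ =>
    inv_pos.1 (pos_of_mul_pos_right (hr0.trans (hDV hθ).2.1) hc0.le)
  set Φ : E → E := fun θ => (N θ)⁻¹ • θ with hΦ
  set Ψ : E → E := fun θ => (ℓ θ)⁻¹ • θ with hΨ
  have hNΦ : ∀ θ ∈ D, N (Φ θ) = 1 := fun θ hθ => by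
    rw [hΦ, hhom _ (inv_pos.2 (hDN θ hθ)), inv_mul_cancel₀ (hDN θ hθ).ne']
  have hΨΦ : ∀ θ ∈ D, Ψ (Φ θ) = Ψ θ := fun θ hθ => by
    have := hDN θ hθ
    have := hDℓ θ hθ
    simp only [hΦ, hΨ, map_smul, smul_eq_mul, smul_smul]
    congr 1
    field_simp
  have hΦΨ : ∀ θ ∈ D, Φ (Ψ θ) = Φ θ := fun θ hθ => by
    have := hDN θ hθ
    have h2 := hDℓ θ hθ
    simp only [hΦ, hΨ, hhom _ (inv_pos.2 h2), smul_smul]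
    congr 1
    field_simp
  have hdist : ∀ θ ∈ D, ∀ η ∈ D,
      ‖(Ψ θ - Ψ η) - (Φ θ - Φ η)‖ ≤ ε * ‖Φ θ - Φ η‖ := fun θ hθ η hη => by
    rw [← hΨΦ θ hθ, ← hΨΦ η hη]
    exact hWT _ (hDV hθ).1 _ (hDV hη).1 (hNΦ θ hθ) (hNΦ η hη)
  have hLΨ : LipschitzOnWith c Ψ (Φ '' D) := by
    refine LipschitzOnWith.of_dist_le_mul ?_
    rintro _ ⟨θ, hθ, rfl⟩ _ ⟨η, hη, rfl⟩
    rw [hΨΦ θ hθ, hΨΦ η hη, dist_eq_norm, dist_eq_norm]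
    have h1 := hdist θ hθ η hη
    have h2 : ‖Ψ θ - Ψ η‖ ≤ ‖(Ψ θ - Ψ η) - (Φ θ - Φ η)‖ + ‖Φ θ - Φ η‖ := norm_le_norm_sub_add _ _
    have h3 : (1 + ε : ℝ) ≤ c := by
      rw [hεc]
      have : 0 ≤ ((c : ℝ) - 1) ^ 2 / c := by positivity
      have h4 : ((c : ℝ) - 1) ^ 2 / c = c - (1 + (1 - (c : ℝ)⁻¹)) := by field_simp; ring
      linarith
    calc ‖Ψ θ - Ψ η‖ ≤ (1 + ε) * ‖Φ θ - Φ η‖ := by linarith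
      _ ≤ c * ‖Φ θ - Φ η‖ := by gcongr
  have hLΦ : LipschitzOnWith c Φ (Ψ '' D) := by
    refine LipschitzOnWith.of_dist_le_mul ?_
    rintro _ ⟨θ, hθ, rfl⟩ _ ⟨η, hη, rfl⟩
    rw [hΦΨ θ hθ, hΦΨ η hη, dist_eq_norm, dist_eq_norm]
    have h1 := hdist θ hθ η hη
    have h2 : ‖Φ θ - Φ η‖ - ‖Ψ θ - Ψ η‖ ≤ ‖(Ψ θ - Ψ η) - (Φ θ - Φ η)‖ := by
      rw [norm_sub_rev (Ψ θ - Ψ η)]; exact norm_sub_norm_le _ _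
    rw [hεc] at h1
    have h3 : (c : ℝ)⁻¹ * ‖Φ θ - Φ η‖ ≤ ‖Ψ θ - Ψ η‖ := by linarith
    rwa [inv_mul_le_iff₀ hc0] at h3
  have himΨ : Ψ '' (Φ '' D) = Ψ '' D := by
    rw [image_image]; exact image_congr hΨΦ
  have himΦ : Φ '' (Ψ '' D) = Φ '' D := by
    rw [image_image]; exact image_congr hΦΨ
  have hΨm : MeasurableSet (Ψ '' D) := by
    refine hDm.image_of_continuousOn_injOn ?_ ?_
    · exact (ℓ.continuous.continuousOn.inv₀ fun θ hθ => (hDℓ θ hθ).ne').smul continuousOn_id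
    · intro θ hθ η hη h
      exact eq_of_pos_smul_eq_of_norm_eq_one (inv_pos.2 (hDℓ θ hθ)) (inv_pos.2 (hDℓ η hη))
        (hD1 θ hθ) (hD1 η hη) h
  have hflat := hκ ℓ hℓ0 (Ψ '' D) hΨm (by
    rintro _ ⟨θ, hθ, rfl⟩
    simp only [hΨ, map_smul, smul_eq_mul]
    exact inv_mul_cancel₀ (hDℓ θ hθ).ne')
  have hH1 : μH[(d : ℝ)] (Φ '' D) ≤ (c : ℝ≥0∞) ^ d * μH[(d : ℝ)] (Ψ '' D) := by
    simpa [himΦ] using hLΦ.hausdorffMeasure_image_le (d := d) (by positivity)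
  have hH2 : μH[(d : ℝ)] (Ψ '' D) ≤ (c : ℝ≥0∞) ^ d * μH[(d : ℝ)] (Φ '' D) := by
    simpa [himΨ] using hLΨ.hausdorffMeasure_image_le (d := d) (by positivity)
  obtain ⟨hv1, hv2⟩ := volume_cone_le_and_le (D := D) (ψ := fun θ => (ℓ θ)⁻¹) hd
    (c := c) (by positivity) hr0 (fun θ hθ => (hDV hθ).2.1.le) (fun θ hθ => (hDV hθ).2.2.le)
  constructor
  · calc μH[(d : ℝ)] (Φ '' D) ≤ (c : ℝ≥0∞) ^ d * μH[(d : ℝ)] (Ψ '' D) := hH1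
      _ ≤ (c : ℝ≥0∞) ^ d * (κ * ‖ℓ‖ₑ * ((c : ℝ≥0∞) ^ (d + 1) *
          (ENNReal.ofReal (r ^ (d + 1)) * volume (Ioo (0 : ℝ) 1 • D)))) := by
        rw [hflat]; gcongr
      _ = _ := by ring
  · calc κ * ‖ℓ‖ₑ * (ENNReal.ofReal (r ^ (d + 1)) * volume (Ioo (0 : ℝ) 1 • D))
        ≤ κ * ‖ℓ‖ₑ * ((c : ℝ≥0∞) ^ (d + 1) * volume (Ioo (0 : ℝ) 1 • (Ψ '' D))) := by gcongr
      _ = (c : ℝ≥0∞) ^ (d + 1) * μH[(d : ℝ)] (Ψ '' D) := by rw [hflat]; ring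
      _ ≤ (c : ℝ≥0∞) ^ (d + 1) * ((c : ℝ≥0∞) ^ d * μH[(d : ℝ)] (Φ '' D)) := by gcongr
      _ = _ := by ring

/-- The density, with respect to the cone measure on the unit sphere, of the surface measure of the
level set `N = 1` of a positively homogeneous function `N` on a space of dimension `n`. -/
def radialDensity {E : Type*} [NormedAddCommGroup E] [NormedSpace ℝ E] (n : ℕ) (N : E → ℝ)
    (θ : E) : ℝ :=
  ‖fderiv ℝ N ((N θ)⁻¹ • θ)‖ * (N θ)⁻¹ ^ n

namespace IsMinkowskiNorm

variable {E : Type*} [NormedAddCommGroup E]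

section NormedSpace

variable [NormedSpace ℝ E] {N : E → ℝ} (hN : IsMinkowskiNorm N)

include hN

theorem inv_smul_ne_zero {θ : E} (hθ : θ ≠ 0) : (N θ)⁻¹ • θ ≠ 0 :=
  smul_ne_zero (inv_ne_zero (hN.pos θ hθ).ne') hθ

theorem map_inv_smul {θ : E} (hθ : θ ≠ 0) : N ((N θ)⁻¹ • θ) = 1 := by
  have := hN.pos θ hθ
  rw [hN.homog _ (by positivity), inv_mul_cancel₀ this.ne']

theorem contDiffAt {y : E} (hy : y ≠ 0) : ContDiffAt ℝ 2 N y :=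
  hN.smooth.contDiffAt (isOpen_compl_singleton.mem_nhds hy)

theorem fderiv_ne_zero {y : E} (hy : y ≠ 0) : fderiv ℝ N y ≠ 0 := by
  intro h
  have := ((hN.contDiffAt hy).differentiableAt (by norm_num)).hasFDerivAt.apply_self_of_homogeneous
    hN.homog
  rw [h] at this
  exact (hN.pos y hy).ne this

theorem radialDensity_pos (n : ℕ) {θ : E} (hθ : θ ≠ 0) : 0 < radialDensity n N θ :=
  mul_pos (norm_pos_iff.2 (hN.fderiv_ne_zero (hN.inv_smul_ne_zero hθ)))
    (pow_pos (inv_pos.2 (hN.pos θ hθ)) n)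

theorem continuousOn_inv_smul : ContinuousOn (fun θ => (N θ)⁻¹ • θ) {0}ᶜ :=
  (hN.continuous.continuousOn.inv₀ fun θ hθ => (hN.pos θ hθ).ne').smul continuousOn_id

theorem continuousOn_radialDensity (n : ℕ) : ContinuousOn (radialDensity n N) {0}ᶜ := by
  have h1 : ContinuousOn (fderiv ℝ N) {0}ᶜ :=
    hN.smooth.continuousOn_fderiv_of_isOpen isOpen_compl_singleton (by norm_num)
  refine (h1.comp hN.continuousOn_inv_smul fun θ hθ => hN.inv_smul_ne_zero hθ).norm.mul ?_
  exact (hN.continuous.continuousOn.inv₀ fun θ hθ => (hN.pos θ hθ).ne').pow n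

theorem continuous_radialDensity_sphere (n : ℕ) :
    Continuous fun θ : sphere (0 : E) 1 => radialDensity n N θ :=
  (hN.continuousOn_radialDensity n).comp_continuous continuous_subtype_val
    fun θ => ne_zero_of_mem_unit_sphere θ

theorem injective_inv_smul_sphere :
    Function.Injective fun θ : sphere (0 : E) 1 => (N θ)⁻¹ • (θ : E) := by
  intro θ η h
  have hθ := hN.pos θ (ne_zero_of_mem_unit_sphere θ)
  have hη := hN.pos η (ne_zero_of_mem_unit_sphere η)
  exact Subtype.ext (eq_of_pos_smul_eq_of_norm_eq_one (inv_pos.2 hθ) (inv_pos.2 hη)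
    (by simp) (by simp) h)

theorem range_inv_smul_sphere :
    range (fun θ : sphere (0 : E) 1 => (N θ)⁻¹ • (θ : E)) = {y | N y = 1} := by
  ext y
  constructor
  · rintro ⟨θ, rfl⟩
    exact hN.map_inv_smul (ne_zero_of_mem_unit_sphere θ)
  · intro hy
    have hy0 : y ≠ 0 := by
      rintro rfl
      exact zero_ne_one (hN.map_zero.symm.trans hy)
    have hn : 0 < ‖y‖ := norm_pos_iff.2 hy0
    refine ⟨⟨‖y‖⁻¹ • y, by simp [norm_smul, hn.ne']⟩, ?_⟩
    change (N (‖y‖⁻¹ • y))⁻¹ • ‖y‖⁻¹ • y = y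
    rw [hN.homog _ (inv_pos.2 hn), show N y = 1 from hy, smul_smul]
    field_simp
    simp

end NormedSpace

section InnerProductSpace

variable [InnerProductSpace ℝ E] [FiniteDimensional ℝ E] [MeasurableSpace E] [BorelSpace E]
  {N : E → ℝ} (hN : IsMinkowskiNorm N)

include hN

theorem measurableEmbedding_inv_smul_sphere :
    MeasurableEmbedding fun θ : sphere (0 : E) 1 => (N θ)⁻¹ • (θ : E) := by
  refine (Continuous.isClosedEmbedding ?_ hN.injective_inv_smul_sphere).measurableEmbedding
  exact hN.continuousOn_inv_smul.comp_continuous continuous_subtype_val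
    fun θ => ne_zero_of_mem_unit_sphere θ

/-- The Hausdorff measure on the indicatrix of a Minkowski norm in polar coordinates. -/
theorem restrict_hausdorffMeasure_indicatrix {d : ℕ} (hd : Module.finrank ℝ E = d + 1) {κ : ℝ≥0}
    (hκ : ∀ ℓ : E →L[ℝ] ℝ, ℓ ≠ 0 → ∀ B : Set E, MeasurableSet B →
      (∀ y ∈ B, ℓ y = 1) → μH[(d : ℝ)] B = κ * ‖ℓ‖ₑ * volume (Ioo (0 : ℝ) 1 • B)) :
    (μH[(d : ℝ)] : Measure E).restrict {y | N y = 1} =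
      ((κ / (d + 1) : ℝ≥0) • (volume : Measure E).toSphere.withDensity
        fun θ => ENNReal.ofReal (radialDensity (d + 1) N θ)).map
          fun θ : sphere (0 : E) 1 => (N θ)⁻¹ • (θ : E) := by
  set J : sphere (0 : E) 1 → ℝ := fun θ => radialDensity (d + 1) N θ with hJ
  have hJc : Continuous J := (hN.continuousOn_radialDensity (d + 1)).comp_continuous
    continuous_subtype_val fun θ => ne_zero_of_mem_unit_sphere θ
  have hJpos : ∀ θ, 0 < J θ := fun θ => hN.radialDensity_pos _ (ne_zero_of_mem_unit_sphere θ)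
  have hemb := hN.measurableEmbedding_inv_smul_sphere
  set Φ : sphere (0 : E) 1 → E := fun θ => (N θ)⁻¹ • (θ : E) with hΦ
  set κ' : ℝ≥0 := κ / (d + 1) with hκ'
  set ν : Measure (sphere (0 : E) 1) :=
    κ' • (volume : Measure E).toSphere.withDensity fun θ => ENNReal.ofReal (J θ) with hν
  have hνA : ∀ A, MeasurableSet A →
      ν A = κ' * ∫⁻ θ in A, ENNReal.ofReal (J θ) ∂(volume : Measure E).toSphere := fun A hA => by
    rw [hν, Measure.smul_apply, withDensity_apply _ hA]; rfl
  have hloc : ∀ C : ℝ≥0, 1 < C → ∀ θ₀ : sphere (0 : E) 1, ∃ V ∈ 𝓝 θ₀, ∀ A ⊆ V, MeasurableSet A →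
      Measure.comap Φ μH[(d : ℝ)] A ≤ C * ν A ∧ ν A ≤ C * Measure.comap Φ μH[(d : ℝ)] A := by
    intro C hC θ₀
    obtain ⟨c, hc, hcC⟩ : ∃ c : ℝ≥0, 1 < c ∧ c ^ (2 * d + 1) * c < C := by
      have h1 : ∀ᶠ c : ℝ≥0 in 𝓝[>] 1, c ^ (2 * d + 1) * c < C := by
        have : Continuous fun c : ℝ≥0 => c ^ (2 * d + 1) * c := by fun_prop
        exact nhdsWithin_le_nhds (this.continuousAt.eventually (gt_mem_nhds (by simpa using hC)))
      have h2 : ∀ᶠ c : ℝ≥0 in 𝓝[>] 1, c ∈ Ioi (1 : ℝ≥0) := self_mem_nhdsWithin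
      exact (h2.and h1).exists
    have hcC' : (c : ℝ≥0∞) ^ (2 * d + 1) * c ≤ C := by exact_mod_cast hcC.le
    have hθ₀ := ne_zero_of_mem_unit_sphere θ₀
    obtain ⟨V, hV, hVD⟩ := exists_nhds_hausdorffMeasure_radialGraph_le_and_le hd hκ hN.pos hN.homog
      hθ₀ ((hN.contDiffAt (hN.inv_smul_ne_zero hθ₀)).hasStrictFDerivAt (by norm_num))
      hN.continuous.continuousAt hc
    have hc1 : (1 : ℝ) < c := hc
    have hev : ∀ᶠ θ : sphere (0 : E) 1 in 𝓝 θ₀, (θ : E) ∈ V ∧ J θ₀ < c * J θ ∧ J θ < c * J θ₀ := by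
      refine (continuous_subtype_val.continuousAt.eventually hV).and (Eventually.and ?_ ?_)
      · exact (hJc.continuousAt.const_mul (c : ℝ)).eventually
          (lt_mem_nhds (lt_mul_of_one_lt_left (hJpos θ₀) hc1))
      · exact hJc.continuousAt.eventually (gt_mem_nhds (lt_mul_of_one_lt_left (hJpos θ₀) hc1))
    refine ⟨_, hev, fun A hAV hA => ?_⟩
    have hmul : ∀ s : ℝ, ENNReal.ofReal (c * s) = c * ENNReal.ofReal s := fun s => by
      rw [ENNReal.ofReal_mul NNReal.zero_le_coe, ENNReal.ofReal_coe_nnreal]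
    set σA := (volume : Measure E).toSphere A with hσA
    have hJm : Measurable fun θ => ENNReal.ofReal (J θ) := hJc.measurable.ennreal_ofReal
    have hI1 : ENNReal.ofReal (J θ₀) * σA ≤
        c * ∫⁻ θ in A, ENNReal.ofReal (J θ) ∂(volume : Measure E).toSphere := by
      rw [← setLIntegral_const, ← lintegral_const_mul _ hJm]
      refine setLIntegral_mono (hJm.const_mul _) fun θ hθ => ?_
      rw [← hmul]
      exact ENNReal.ofReal_le_ofReal (hAV hθ).2.1.le
    have hI2 : ∫⁻ θ in A, ENNReal.ofReal (J θ) ∂(volume : Measure E).toSphere ≤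
        c * (ENNReal.ofReal (J θ₀) * σA) := by
      rw [← mul_assoc, ← hmul, ← setLIntegral_const]
      exact setLIntegral_mono measurable_const fun θ hθ =>
        ENNReal.ofReal_le_ofReal (hAV hθ).2.2.le
    have hκσ : κ * ‖fderiv ℝ N ((N θ₀)⁻¹ • (θ₀ : E))‖ₑ * (ENNReal.ofReal ((N θ₀)⁻¹ ^ (d + 1)) *
        volume (Ioo (0 : ℝ) 1 • (Subtype.val '' A))) = κ' * (ENNReal.ofReal (J θ₀) * σA) := by
      have h1 : (κ : ℝ≥0∞) = κ' * (d + 1 : ℕ) := by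
        rw [hκ']
        norm_cast
        rw [div_mul_cancel₀]
        positivity
      have h2 : J θ₀ = ‖fderiv ℝ N ((N θ₀)⁻¹ • (θ₀ : E))‖ * (N θ₀)⁻¹ ^ (d + 1) := rfl
      rw [hσA, Measure.toSphere_apply' _ hA, hd, h2,
        ENNReal.ofReal_mul (norm_nonneg _), ofReal_norm, h1]
      ring
    obtain ⟨hD1, hD2⟩ := hVD (Subtype.val '' A) (image_subset_iff.2 fun θ hθ => (hAV hθ).1)
      ((MeasurableEmbedding.subtype_coe isClosed_sphere.measurableSet).measurableSet_image.2 hA)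
      (by rintro _ ⟨θ, -, rfl⟩; exact θ.2)
    rw [hκσ, image_image] at hD1 hD2
    rw [hemb.comap_apply, hνA A hA]
    constructor
    · calc μH[(d : ℝ)] (Φ '' A) ≤ (c : ℝ≥0∞) ^ (2 * d + 1) *
            (κ' * (c * ∫⁻ θ in A, ENNReal.ofReal (J θ) ∂(volume : Measure E).toSphere)) :=
          hD1.trans (by gcongr)
        _ = ((c : ℝ≥0∞) ^ (2 * d + 1) * c) *
            (κ' * ∫⁻ θ in A, ENNReal.ofReal (J θ) ∂(volume : Measure E).toSphere) := by ring
        _ ≤ _ := by gcongr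
    · calc κ' * ∫⁻ θ in A, ENNReal.ofReal (J θ) ∂(volume : Measure E).toSphere
          ≤ c * (κ' * (ENNReal.ofReal (J θ₀) * σA)) := by
            rw [mul_left_comm]; gcongr
        _ ≤ c * ((c : ℝ≥0∞) ^ (2 * d + 1) * μH[(d : ℝ)] (Φ '' A)) := by gcongr
        _ = ((c : ℝ≥0∞) ^ (2 * d + 1) * c) * μH[(d : ℝ)] (Φ '' A) := by ring
        _ ≤ _ := by gcongr
  have heq : Measure.comap Φ μH[(d : ℝ)] = ν := by
    refine le_antisymm ?_ ?_ <;> refine measure_le_of_forall_locally_le_mul fun C hC θ₀ => ?_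
    · obtain ⟨V, hV, h⟩ := hloc C hC θ₀
      exact ⟨V, hV, fun A hA hAm => (h A hA hAm).1⟩
    · obtain ⟨V, hV, h⟩ := hloc C hC θ₀
      exact ⟨V, hV, fun A hA hAm => (h A hA hAm).2⟩
  rw [← heq, hemb.map_comap, hN.range_inv_smul_sphere]

end InnerProductSpace

end IsMinkowskiNorm

namespace IsMinkowskiNorm

variable {E : Type*} [NormedAddCommGroup E] [InnerProductSpace ℝ E] [FiniteDimensional ℝ E]
  [MeasurableSpace E] [BorelSpace E] {N : E → ℝ} (hN : IsMinkowskiNorm N)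

include hN

/-- Integration over the indicatrix of a Minkowski norm in polar coordinates. -/
theorem setIntegral_hausdorffMeasure_indicatrix {d : ℕ} (hd : Module.finrank ℝ E = d + 1) {κ : ℝ≥0}
    (hκ : ∀ ℓ : E →L[ℝ] ℝ, ℓ ≠ 0 → ∀ B : Set E, MeasurableSet B →
      (∀ y ∈ B, ℓ y = 1) → μH[(d : ℝ)] B = κ * ‖ℓ‖ₑ * volume (Ioo (0 : ℝ) 1 • B)) (f : E → ℝ) :
    ∫ y in {y | N y = 1}, f y ∂μH[(d : ℝ)] =
      (κ / (d + 1) : ℝ≥0) * ∫ θ : sphere (0 : E) 1,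
        radialDensity (d + 1) N θ * f ((N θ)⁻¹ • (θ : E)) ∂(volume : Measure E).toSphere := by
  rw [hN.restrict_hausdorffMeasure_indicatrix hd hκ,
    hN.measurableEmbedding_inv_smul_sphere.integral_map, integral_smul_nnreal_measure,
    integral_withDensity_eq_integral_toReal_smul
      (hN.continuous_radialDensity_sphere _).measurable.ennreal_ofReal
      (Eventually.of_forall fun _ => ENNReal.ofReal_lt_top), NNReal.smul_def, smul_eq_mul]
  congr 1
  refine integral_congr_ae (Eventually.of_forall fun θ => ?_)
  simp only [smul_eq_mul]
  rw [ENNReal.toReal_ofReal (hN.radialDensity_pos _ (ne_zero_of_mem_unit_sphere θ)).le]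

theorem hausdorffMeasure_indicatrix_pos_and_lt_top {d : ℕ} (hd : Module.finrank ℝ E = d + 1)
    {κ : ℝ≥0} (hκ0 : κ ≠ 0)
    (hκ : ∀ ℓ : E →L[ℝ] ℝ, ℓ ≠ 0 → ∀ B : Set E, MeasurableSet B →
      (∀ y ∈ B, ℓ y = 1) → μH[(d : ℝ)] B = κ * ‖ℓ‖ₑ * volume (Ioo (0 : ℝ) 1 • B)) :
    0 < (μH[(d : ℝ)] : Measure E) {y | N y = 1} ∧
      (μH[(d : ℝ)] : Measure E) {y | N y = 1} < ⊤ := by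
  have hJ := hN.continuous_radialDensity_sphere (d + 1)
  have hJm : Measurable fun θ : sphere (0 : E) 1 => ENNReal.ofReal (radialDensity (d + 1) N θ) :=
    hJ.measurable.ennreal_ofReal
  have : Nontrivial E := Module.nontrivial_of_finrank_eq_succ hd
  have h := congrArg (fun μ : Measure E => μ univ) (hN.restrict_hausdorffMeasure_indicatrix hd hκ)
  simp only [Measure.restrict_apply_univ] at h
  rw [Measure.map_apply hN.measurableEmbedding_inv_smul_sphere.measurable .univ, preimage_univ,
    Measure.smul_apply, withDensity_apply _ .univ, Measure.restrict_univ, ENNReal.smul_def,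
    smul_eq_mul] at h
  rw [h]
  constructor
  · refine ENNReal.mul_pos (by simpa using hκ0) (ne_of_gt ?_)
    rw [lintegral_pos_iff_support hJm]
    have hs : Function.support (fun θ : sphere (0 : E) 1 =>
        ENNReal.ofReal (radialDensity (d + 1) N θ)) = univ := by
      ext θ
      simpa using hN.radialDensity_pos _ (ne_zero_of_mem_unit_sphere θ)
    rw [hs, pos_iff_ne_zero, Measure.measure_univ_ne_zero]
    exact Measure.toSphere_ne_zero _
  · refine ENNReal.mul_lt_top ENNReal.coe_lt_top ?_
    have : Integrable (fun θ : sphere (0 : E) 1 => radialDensity (d + 1) N θ)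
        (volume : Measure E).toSphere :=
      integrableOn_univ.1 (hJ.continuousOn.integrableOn_compact isCompact_univ)
    exact this.lintegral_lt_top

end IsMinkowskiNorm

section JointSmoothness

variable {X E G : Type*} [NormedAddCommGroup X] [NormedSpace ℝ X]
  [NormedAddCommGroup G] [NormedSpace ℝ G]

theorem ContDiffAt.uncurry_fderiv [NormedAddCommGroup E] [NormedSpace ℝ E] {F : X → E → G}
    {m n : WithTop ℕ∞} (hmn : m + 1 ≤ n) {x : X} {z : E}
    (hF : ContDiffAt ℝ n (Function.uncurry F) (x, z)) :
    ContDiffAt ℝ m (Function.uncurry fun x z => fderiv ℝ (F x) z) (x, z) := by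
  refine ContDiffAt.fderiv (f := fun p : X × E => F p.1) (g := Prod.snd) ?_ contDiffAt_snd hmn
  exact ContDiffAt.comp (f := fun q : (X × E) × E => (q.1.1, q.2)) ((x, z), z) hF (by fun_prop)

theorem ContDiffAt.uncurry_fundTensor [NormedAddCommGroup E] [NormedSpace ℝ E] {F : X → E → ℝ}
    {x : X} {z : E} (hF : ContDiffAt ℝ 4 (Function.uncurry F) (x, z)) (u v : E) :
    ContDiffAt ℝ 2 (Function.uncurry fun x z => fundTensor (F x) z u v) (x, z) := by
  have h0 : ContDiffAt ℝ 4 (Function.uncurry fun x z => F x z ^ 2) (x, z) := hF.pow 2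
  have h1 := h0.uncurry_fderiv (m := 3) (by norm_num)
  have h2 := h1.uncurry_fderiv (m := 2) (by norm_num)
  exact contDiffAt_const.mul ((h2.clm_apply contDiffAt_const).clm_apply contDiffAt_const)

/-- The operator norm of functionals on a Hilbert space is smooth away from zero. -/
theorem ContDiffAt.norm_dual [NormedAddCommGroup E] [InnerProductSpace ℝ E] [CompleteSpace E]
    {n : WithTop ℕ∞} {f : X → E →L[ℝ] ℝ} {x : X} (hf : ContDiffAt ℝ n f x) (h0 : f x ≠ 0) :
    ContDiffAt ℝ n (fun x => ‖f x‖) x := by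
  have hlin : IsBoundedLinearMap ℝ fun L : E →L[ℝ] ℝ => (InnerProductSpace.toDual ℝ E).symm L :=
    IsLinearMap.with_bound ⟨by simp, by simp⟩ 1 (by simp)
  have h := (hlin.contDiff.contDiffAt.comp x hf).norm ℝ (by simpa using h0)
  simpa [Function.comp_def] using h

theorem ContDiffAt.prodMk_inv_smul [NormedAddCommGroup E] [NormedSpace ℝ E] {F : X → E → ℝ}
    {n : WithTop ℕ∞} {x : X} {y : E} (hF : ContDiffAt ℝ n (Function.uncurry F) (x, y))
    (h0 : F x y ≠ 0) :
    ContDiffAt ℝ n (fun p : X × E => (p.1, (F p.1 p.2)⁻¹ • p.2)) (x, y) :=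
  contDiffAt_fst.prodMk ((hF.inv h0).smul contDiffAt_snd)

end JointSmoothness

theorem ContDiffAt.uncurry_radialDensity {X E : Type*} [NormedAddCommGroup X] [NormedSpace ℝ X]
    [NormedAddCommGroup E] [InnerProductSpace ℝ E] [CompleteSpace E] {F : X → E → ℝ} (k : ℕ)
    {x : X} (hN : IsMinkowskiNorm (F x)) {y : E} (hy : y ≠ 0)
    (hF : ∀ z ≠ 0, ContDiffAt ℝ 4 (Function.uncurry F) (x, z)) :
    ContDiffAt ℝ 2 (Function.uncurry fun x => radialDensity k (F x)) (x, y) := by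
  have h1 : ContDiffAt ℝ 2 (fun p : X × E => (F p.1 p.2)⁻¹) (x, y) :=
    ((hF y hy).inv (hN.pos y hy).ne').of_le (by norm_num)
  have h2 : ContDiffAt ℝ 2 (fun p : X × E => fderiv ℝ (F p.1) ((F p.1 p.2)⁻¹ • p.2)) (x, y) :=
    ContDiffAt.comp (f := fun p : X × E => (p.1, (F p.1 p.2)⁻¹ • p.2)) (x, y)
      ((hF _ (hN.inv_smul_ne_zero hy)).uncurry_fderiv (m := 2) (by norm_num))
      (((hF y hy).prodMk_inv_smul (hN.pos y hy).ne').of_le (by norm_num))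
  exact (h2.norm_dual (hN.fderiv_ne_zero (hN.inv_smul_ne_zero hy))).mul (h1.pow k)

/-- regularity of the averaged metric: for a `C⁴` Finsler metric `F` on an
open set `U ⊆ ℝ^m`, the averaged metric `x ↦ (∫_{S_x} g(x,y)[u,v] dλ)/λ(S_x)` is well
defined and `C²` on `U`. -/
theorem averaged_metric_regularity
    {m : ℕ} (hm : 2 ≤ m) (U : Set (EuclideanSpace ℝ (Fin m))) (hU : IsOpen U)
    (F : EuclideanSpace ℝ (Fin m) → EuclideanSpace ℝ (Fin m) → ℝ)
    (hFcont : ContinuousOn (fun p : EuclideanSpace ℝ (Fin m) × EuclideanSpace ℝ (Fin m)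
        => F p.1 p.2) (U ×ˢ Set.univ))
    (hFsmooth : ContDiffOn ℝ 4
        (fun p : EuclideanSpace ℝ (Fin m) × EuclideanSpace ℝ (Fin m) => F p.1 p.2)
        (U ×ˢ ({0}ᶜ : Set (EuclideanSpace ℝ (Fin m)))))
    (hFmink : ∀ x ∈ U, IsMinkowskiNorm (F x)) :
    ∀ u v : EuclideanSpace ℝ (Fin m),
      (∀ x ∈ U, 0 < μH[(m : ℝ) - 1] {y : EuclideanSpace ℝ (Fin m) | F x y = 1} ∧
          μH[(m : ℝ) - 1] {y : EuclideanSpace ℝ (Fin m) | F x y = 1} < ⊤) ∧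
      ContDiffOn ℝ 2
        (fun x => (∫ y in {y : EuclideanSpace ℝ (Fin m) | F x y = 1},
              fundTensor (F x) y u v ∂(μH[(m : ℝ) - 1] : Measure (EuclideanSpace ℝ (Fin m))))
            / ((μH[(m : ℝ) - 1] : Measure (EuclideanSpace ℝ (Fin m)))
                {y : EuclideanSpace ℝ (Fin m) | F x y = 1}).toReal)
        U := by
  intro u v
  obtain ⟨d, rfl⟩ : ∃ d, m = d + 1 := ⟨m - 1, by omega⟩
  have hd : Module.finrank ℝ (EuclideanSpace ℝ (Fin (d + 1))) = d + 1 := by simp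
  have hdim : ((d + 1 : ℕ) : ℝ) - 1 = d := by push_cast; ring
  rw [hdim]
  obtain ⟨κ, hκ0, hκ⟩ := exists_hausdorffMeasure_eq_volume_cone _ hd
  have hpos : ∀ x ∈ U, 0 < μH[(d : ℝ)] {y : EuclideanSpace ℝ (Fin (d + 1)) | F x y = 1} ∧
      μH[(d : ℝ)] {y : EuclideanSpace ℝ (Fin (d + 1)) | F x y = 1} < ⊤ := fun x hx =>
    (hFmink x hx).hausdorffMeasure_indicatrix_pos_and_lt_top hd hκ0 hκ
  refine ⟨hpos, ?_⟩
  have hF : ∀ x ∈ U, ∀ z ≠ 0, ContDiffAt ℝ 4 (Function.uncurry F) (x, z) := fun x hx z hz =>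
    hFsmooth.contDiffAt ((hU.prod isOpen_compl_singleton).mem_nhds ⟨hx, hz⟩)
  have hsmooth : ∀ f : EuclideanSpace ℝ (Fin (d + 1)) → EuclideanSpace ℝ (Fin (d + 1)) → ℝ,
      (∀ x ∈ U, ∀ z ≠ 0, ContDiffAt ℝ 2 (Function.uncurry f) (x, z)) →
      ContDiffOn ℝ 2 (fun x => ∫ y in {y | F x y = 1}, f x y ∂μH[(d : ℝ)]) U := by
    intro f hf
    have hψ : ContDiffOn ℝ (2 : ℕ) (Function.uncurry fun x y =>
        radialDensity (d + 1) (F x) y * f x ((F x y)⁻¹ • y)) (U ×ˢ {0}ᶜ) := by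
      rintro ⟨x, y⟩ ⟨hx, hy⟩
      refine ContDiffAt.contDiffWithinAt ?_
      have hN := hFmink x hx
      refine (ContDiffAt.uncurry_radialDensity (d + 1) hN hy (hF x hx)).mul ?_
      exact ContDiffAt.comp (f := fun p : EuclideanSpace ℝ (Fin (d + 1)) × _ =>
          (p.1, (F p.1 p.2)⁻¹ • p.2)) (x, y)
        (hf x hx _ (hN.inv_smul_ne_zero hy))
        (((hF x hx y hy).prodMk_inv_smul (hN.pos y hy).ne').of_le (by norm_num))
    refine ContDiffOn.congr (contDiffOn_const.mul (contDiffOn_integral_of_compactSpace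
      (volume : Measure (EuclideanSpace ℝ (Fin (d + 1)))).toSphere hU isOpen_compl_singleton
      continuous_subtype_val (fun θ : sphere (0 : EuclideanSpace ℝ (Fin (d + 1))) 1 => ne_zero_of_mem_unit_sphere θ) 2
      hψ)) fun x hx =>
      (hFmink x hx).setIntegral_hausdorffMeasure_indicatrix hd hκ (f x)
  have hvol : ∀ x, (μH[(d : ℝ)] {y : EuclideanSpace ℝ (Fin (d + 1)) | F x y = 1}).toReal =
      ∫ y in {y : EuclideanSpace ℝ (Fin (d + 1)) | F x y = 1}, (1 : ℝ) ∂μH[(d : ℝ)] := fun x => by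
    simp [Measure.real]
  refine (hsmooth (fun x y => fundTensor (F x) y u v)
    fun x hx z hz => (hF x hx z hz).uncurry_fundTensor u v).div ?_ fun x hx => ?_
  · simp only [hvol]
    exact hsmooth (fun _ _ => 1) fun _ _ _ _ => contDiffAt_const
  · exact (ENNReal.toReal_pos (hpos x hx).1.ne' (hpos x hx).2.ne).ne'
end
end
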